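/- Let G be a finite simple graph with an even number of vertices and let m ≥ 0 be an integer. If M = {e_1, …, e_{m+1}} is a matching of G consisting of m+1 edges which is not extendable (i.e., no perfect matching of G contains M), then there exists a set S ⊆ V(G) such that S contains every endpoint of every edge of M and |S| ≤ C_o(G − S) + 2m. -/

import Mathlib

/-- The number of odd components of the graph obtained from `G` by deleting
the vertex set `S`, i.e. of the subgraph of `G` induced on `Sᶜ`. -/
noncomputable def cardOddComponents {V : Type} (G : SimpleGraph V) (S : Set V) : ℕ :=
  Nat.card {c : (G.induce Sᶜ).ConnectedComponent // Odd (Nat.card c.supp)}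

namespace SimpleGraph

variable {V W : Type*} {G : SimpleGraph V}

/-- Deleting `u` from `G - s` is the same as deleting `s ∪ u` from `G`. -/
def deleteVertsInduceComplIso (G : SimpleGraph V) (s : Set V) (u : Set ↥sᶜ) :
    ((⊤ : (G.induce sᶜ).Subgraph).deleteVerts u).coe ≃g
      G.induce (s ∪ Subtype.val '' u)ᶜ where
  toFun x := ⟨x.1.1, by
    rintro (h | ⟨y, hy, hyx⟩)
    · exact x.1.2 h
    · exact x.2.2 (Subtype.val_injective hyx ▸ hy)⟩
  invFun x := ⟨⟨x.1, fun h ↦ x.2 (Or.inl h)⟩, trivial, fun h ↦ x.2 (Or.inr ⟨_, h, rfl⟩)⟩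
  left_inv _ := rfl
  right_inv _ := rfl
  map_rel_iff' {x y} := by
    have hx := x.2.2
    have hy := y.2.2
    simp [hx, hy]

lemma Iso.ncard_oddComponents_eq {G' : SimpleGraph W} (φ : G ≃g G') :
    G.oddComponents.ncard = G'.oddComponents.ncard := by
  refine Set.ncard_congr' (φ.connectedComponentEquiv.subtypeEquiv fun c ↦ ?_)
  change Odd c.supp.ncard ↔ Odd (φ.connectedComponentEquiv c).supp.ncard
  rw [Set.ncard_congr' (ConnectedComponent.isoEquivSupp φ c)]

/-- A Tutte violator of a graph of even order has a surplus of at least two odd components. -/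
lemma IsTutteViolator.ncard_add_two_le [Finite V] {u : Set V} (h : G.IsTutteViolator u)
    (hV : Even (Nat.card V)) :
    u.ncard + 2 ≤ ((⊤ : G.Subgraph).deleteVerts u).coe.oddComponents.ncard := by
  have hodd := ((⊤ : G.Subgraph).deleteVerts u).coe.odd_ncard_oddComponents
  have hcard : Nat.card ((⊤ : G.Subgraph).deleteVerts u).verts + u.ncard = Nat.card V := by
    rw [Nat.card_coe_set_eq, Subgraph.deleteVerts_verts, Subgraph.verts_top,
      ← Set.compl_eq_univ_sdiff, add_comm, Set.ncard_add_ncard_compl]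
  rw [IsTutteViolator] at h
  grind

lemma Subgraph.IsMatching.ncard_verts [Finite V] {M : G.Subgraph} (hM : M.IsMatching) :
    M.verts.ncard = 2 * M.edgeSet.ncard := by
  classical
  cases nonempty_fintype V
  have hdeg := M.coe.sum_degrees_eq_twice_card_edges
  have hone (v : M.verts) [Fintype (M.coe.neighborSet v)] : M.coe.degree v = 1 := by
    rw [Subgraph.coe_degree]
    convert Subgraph.isMatching_iff_forall_degree.mp hM v v.2
  rw [← M.image_coe_edgeSet_coe,
    Set.ncard_image_of_injective _ (Sym2.map.injective Subtype.val_injective),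
    ← coe_edgeFinset, Set.ncard_coe_finset, ← hdeg]
  simp only [hone, Finset.sum_const, smul_eq_mul, mul_one, Finset.card_univ,
    ← Nat.card_eq_fintype_card, Nat.card_coe_set_eq]

/-- A matching of `G` together with a perfect matching of the rest of `G` yields a perfect
matching of `G`. -/
lemma Subgraph.IsMatching.exists_isPerfectMatching_of_induce_compl {M : G.Subgraph}
    (hM : M.IsMatching) {P : (G.induce M.vertsᶜ).Subgraph} (hP : P.IsPerfectMatching) :
    ∃ Q : G.Subgraph, Q.IsPerfectMatching ∧ M.edgeSet ⊆ Q.edgeSet := by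
  let f := (Embedding.induce (G := G) M.vertsᶜ).toHom
  have hf : (P.map f).IsMatching := hP.1.map f Subtype.val_injective
  have hverts : (P.map f).verts = M.vertsᶜ := by
    rw [Subgraph.map_verts, hP.2.verts_eq_univ, Set.image_univ]
    exact Subtype.range_coe
  refine ⟨M ⊔ P.map f, ⟨hM.sup hf ?_, ?_⟩, Subgraph.edgeSet_mono le_sup_left⟩
  · rw [hM.support_eq_verts, hf.support_eq_verts, hverts]
    exact disjoint_compl_right
  · rw [Subgraph.isSpanning_iff, Subgraph.verts_sup, hverts, Set.union_compl_self]

end SimpleGraph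

lemma cardOddComponents_eq_ncard_oddComponents {V : Type} (G : SimpleGraph V) (S : Set V) :
    cardOddComponents G S = (G.induce Sᶜ).oddComponents.ncard := rfl

theorem stmt_0 {V : Type} [Fintype V] (G : SimpleGraph V) (m : ℕ)
    (hEven : Even (Fintype.card V))
    (M : G.Subgraph) (hM : M.IsMatching) (hMcard : M.edgeSet.ncard = m + 1)
    (hnotext : ¬ ∃ P : G.Subgraph, P.IsPerfectMatching ∧ M.edgeSet ⊆ P.edgeSet) :
    ∃ S : Set V, M.support ⊆ S ∧ S.ncard ≤ cardOddComponents G S + 2 * m := by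
  have hverts : M.verts.ncard = 2 * (m + 1) := hMcard ▸ hM.ncard_verts
  have hcompl : Even (Nat.card ↥M.vertsᶜ) := by
    have := M.verts.ncard_add_ncard_compl
    rw [Nat.card_coe_set_eq]
    rw [← Nat.card_eq_fintype_card] at hEven
    grind
  obtain ⟨u, hu⟩ := SimpleGraph.exists_isTutteViolator
    (fun P hP ↦ hnotext (hM.exists_isPerfectMatching_of_induce_compl hP)) hcompl
  refine ⟨M.verts ∪ Subtype.val '' u, hM.support_eq_verts.trans_subset Set.subset_union_left, ?_⟩
  have hle := hu.ncard_add_two_le hcompl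
  rw [(G.deleteVertsInduceComplIso M.verts u).ncard_oddComponents_eq] at hle
  have hunion := Set.ncard_union_le M.verts (Subtype.val '' u)
  rw [Set.ncard_image_of_injective u Subtype.val_injective] at hunion
  rw [cardOddComponents_eq_ncard_oddComponents]
  omega
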